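/- Let a,b,c,d,e be real with 0 < a, 0 < b, 0 < d, e < 1, c - e + 1 > 0, and with e - c not an integer. Let 0 < s < 1 and 1-s < t < 1. Then I₆(s,t) = [B(a, c-e)/d] · s^{a+c-e-1} t^{b-1} (s+t-1)^{d} · F̃₃(1, 1-b; e-a-c+1, d; d+1; e; e-c+1; (s+t-1)/s, (s+t-1)/t) + B(1-e, e-c) B(d, 1-e+c) s^{a-1} t^{b-1} (s+t-1)^{c+d-e} · F₃(1-a, 1-b; c, d; c+d-e+1; (s+t-1)/s, (s+t-1)/t). -/

import Mathlib

open Real intervalIntegral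

/-- The Pochhammer symbol `(a)_k = a(a+1)⋯(a+k-1) = Γ(a+k)/Γ(a)`. -/
noncomputable def poch (a : ℝ) (k : ℕ) : ℝ := ∏ i ∈ Finset.range k, (a + (i : ℝ))

/-- The Beta function `B(x,y) = Γ(x)Γ(y)/Γ(x+y)`. -/
noncomputable def Beta2 (x y : ℝ) : ℝ := Real.Gamma x * Real.Gamma y / Real.Gamma (x + y)

/-- Extended Beta function `B(x,y,z) = Γ(x)Γ(y)Γ(z)/Γ(x+y+z)`. -/
noncomputable def Beta3 (x y z : ℝ) : ℝ :=
  Real.Gamma x * Real.Gamma y * Real.Gamma z / Real.Gamma (x + y + z)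

/-- The third Appell hypergeometric function
`F₃(a₁,a₂; b₁,b₂; c; x,y) = Σ_{i,j} (a₁)_i(a₂)_j(b₁)_i(b₂)_j/((c)_{i+j} i! j!) xⁱ yʲ`. -/
noncomputable def F3 (a₁ a₂ b₁ b₂ c x y : ℝ) : ℝ :=
  ∑' (i : ℕ) (j : ℕ),
    poch a₁ i * poch a₂ j * poch b₁ i * poch b₂ j /
      (poch c (i + j) * (Nat.factorial i : ℝ) * (Nat.factorial j : ℝ)) * x ^ i * y ^ j

/-- Olsson's function
`F_P(a,b₁,b₂,c₁,c₂;x,y) = y^{-a} Σ_{i,j} (a)_{i+j}(a-c₂+1)_i(b₂)_j(b₁)_i /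
((a+b₂-c₂+1)_{i+j}(c₁)_i i! j!) xⁱ (1-y)ʲ`. -/
noncomputable def FP (a b₁ b₂ c₁ c₂ x y : ℝ) : ℝ :=
  y ^ (-a) *
    ∑' (i : ℕ) (j : ℕ),
      poch a (i + j) * poch (a - c₂ + 1) i * poch b₂ j * poch b₁ i /
        (poch (a + b₂ - c₂ + 1) (i + j) * poch c₁ i *
          (Nat.factorial i : ℝ) * (Nat.factorial j : ℝ)) * x ^ i * (1 - y) ^ j

/-- The extended `F₃` function
`F̃₃(a₁,a₂;b₁,b₂;c;d₁;d₂;x,y) = Σ_{i,j} (a₁)_i(a₂)_j(b₁)_i(b₂)_j(d₁)_i /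
((c)_{i+j}(d₂)_i i! j!) xⁱ yʲ`. -/
noncomputable def F3t (a₁ a₂ b₁ b₂ c d₁ d₂ x y : ℝ) : ℝ :=
  ∑' (i : ℕ) (j : ℕ),
    poch a₁ i * poch a₂ j * poch b₁ i * poch b₂ j * poch d₁ i /
      (poch c (i + j) * poch d₂ i * (Nat.factorial i : ℝ) * (Nat.factorial j : ℝ)) *
      x ^ i * y ^ j

/-- `I₅(s,t) = ∫₀^{1-s} (∫₀ˢ u^{a-1}(s-u)^{c-1}(1-u-v)^{-e} du)
v^{b-1}(t-v)^{d-1} dv`. -/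
noncomputable def I5 (a b c d e s t : ℝ) : ℝ :=
  ∫ v in (0:ℝ)..(1 - s),
    (∫ u in (0:ℝ)..s, u ^ (a - 1) * (s - u) ^ (c - 1) * (1 - u - v) ^ (-e)) *
      v ^ (b - 1) * (t - v) ^ (d - 1)

/-- `I₆(s,t) = ∫_{1-s}^{t} (∫₀^{1-v} u^{a-1}(s-u)^{c-1}(1-u-v)^{-e} du)
v^{b-1}(t-v)^{d-1} dv`. -/
noncomputable def I6 (a b c d e s t : ℝ) : ℝ :=
  ∫ v in (1 - s)..t,
    (∫ u in (0:ℝ)..(1 - v), u ^ (a - 1) * (s - u) ^ (c - 1) * (1 - u - v) ^ (-e)) *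
      v ^ (b - 1) * (t - v) ^ (d - 1)

noncomputable def bc (a : ℝ) (n : ℕ) : ℝ := poch a n / (Nat.factorial n : ℝ)

lemma poch_zero (a : ℝ) : poch a 0 = 1 := by simp [poch]
lemma poch_succ (a : ℝ) (n : ℕ) : poch a (n+1) = poch a n * (a + n) := by
  simp [poch, Finset.prod_range_succ]

lemma poch_ne_zero (a : ℝ) (h : ∀ m : ℕ, a + m ≠ 0) (n : ℕ) : poch a n ≠ 0 := by
  unfold poch
  exact Finset.prod_ne_zero_iff.mpr fun i _ => h i

lemma poch_one (n : ℕ) : poch 1 n = (Nat.factorial n : ℝ) := by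
  induction n with
  | zero => simp [poch]
  | succ n ih => rw [poch_succ, ih, Nat.factorial_succ]; push_cast; ring

lemma fac_ne (n : ℕ) : (Nat.factorial n : ℝ) ≠ 0 := by positivity

lemma bc_zero (a : ℝ) : bc a 0 = 1 := by simp [bc, poch]

lemma bc_succ (a : ℝ) (n : ℕ) : bc a (n+1) = bc a n * ((a + n) / (n + 1)) := by
  unfold bc
  rw [poch_succ, Nat.factorial_succ]
  have := fac_ne n
  push_cast
  field_simp

lemma bc_pascal (a : ℝ) (n : ℕ) : bc (a-1) (n+1) = bc a (n+1) - bc a n := by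
  induction n with
  | zero => simp [bc_succ, bc_zero]
  | succ n ih =>
    rw [bc_succ, ih, bc_succ a (n+1), bc_succ a n]
    push_cast
    field_simp
    ring

lemma choose_eq_bc (a : ℝ) (n : ℕ) : Ring.choose (a + n - 1) n = bc a n := by
  have h : Ring.choose (a + n - 1) n = Ring.multichoose a n := by
    rw [Ring.choose]; congr 1; ring
  rw [h]
  have h2 := Ring.factorial_nsmul_multichoose_eq_ascPochhammer a n
  have h3 : ∀ n : ℕ, (ascPochhammer ℕ n).smeval a = poch a n := by
    intro n
    rw [Polynomial.ascPochhammer_smeval_eq_eval]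
    induction n with
    | zero => simp [poch]
    | succ n ih => rw [ascPochhammer_succ_eval, poch_succ, ih]
  rw [h3] at h2
  unfold bc
  rw [← h2, nsmul_eq_mul]
  have := fac_ne n
  field_simp

lemma binom_hasSum (a x : ℝ) (hx : |x| < 1) :
    HasSum (fun n => bc a n * x ^ n) ((1 - x) ^ (-a)) := by
  have h := (Real.one_div_one_sub_rpow_hasFPowerSeriesOnBall_zero a).hasSum (y := x)
    (by simpa [enorm_eq_nnnorm, ← NNReal.coe_lt_coe] using hx)
  rw [zero_add] at h
  have e : (1 - x) ^ (-a) = 1 / (1 - x) ^ a := by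
    rw [Real.rpow_neg (by linarith [le_abs_self x])]; simp
  rw [e]
  have h4 : (fun n => bc a n * x ^ n) = fun n =>
    (FormalMultilinearSeries.ofScalars ℝ (fun n : ℕ => Ring.choose (a + ↑n - 1) n) n) fun _ => x := by
    ext n
    simp [choose_eq_bc, mul_comm]
  rw [h4]
  exact h

/-- General `2F1` coefficient summability. -/
lemma hyp_summable (α β γ x : ℝ) (hx0 : 0 ≤ x) (hx : x < 1) :
    Summable (fun n => |bc α n * (poch β n / poch γ n)| * x ^ n) := by
  obtain ⟨r, hr1, hr2⟩ := exists_between hx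
  apply summable_of_ratio_norm_eventually_le (r := r) hr2
  have t1 : ∀ p q : ℝ, Filter.Tendsto (fun n : ℕ => (p + n) / (q + n)) Filter.atTop (nhds 1) := by
    intro p q
    have h0 : Filter.Tendsto (fun n : ℕ => 1 + (p - q) / (q + (n:ℝ))) Filter.atTop (nhds (1 + 0)) := by
      apply Filter.Tendsto.const_add
      apply Filter.Tendsto.div_atTop tendsto_const_nhds
      exact Filter.tendsto_atTop_add_const_left _ _ tendsto_natCast_atTop_atTop
    rw [add_zero] at h0
    refine h0.congr' ?_
    obtain ⟨N, hN⟩ := exists_nat_gt (-q)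
    filter_upwards [Filter.eventually_ge_atTop N] with n hn
    have : (N:ℝ) ≤ n := by exact_mod_cast hn
    have : q + n ≠ 0 := by linarith
    field_simp
    ring
  have t2 := (((t1 α 1).mul (t1 β γ)).abs.mul_const x)
  simp only [mul_one, abs_one, one_mul] at t2
  filter_upwards [t2.eventually (gt_mem_nhds hr1)] with n hn
  rw [bc_succ, poch_succ, poch_succ]
  have e : bc α n * ((α + n) / (n + 1)) * (poch β n * (β + n) / (poch γ n * (γ + n)))
      = (bc α n * (poch β n / poch γ n)) * ((α + n) / (1 + n) * ((β + n) / (γ + n))) := by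
    rw [add_comm (n:ℝ) 1, mul_div_mul_comm]; ring
  rw [e, abs_mul, pow_succ]
  simp only [norm_mul, Real.norm_eq_abs, abs_abs, abs_pow, abs_of_nonneg hx0]
  have : 0 ≤ |bc α n * (poch β n / poch γ n)| * x ^ n := by positivity
  rw [abs_mul (bc α n)] at this
  calc _ = (|α + n| / |1 + (n:ℝ)| * (|β + n| / |γ + n|) * x) * (|bc α n| * |poch β n / poch γ n| * x^n) := by
        simp only [abs_mul, abs_div]; ring
    _ ≤ r * (|bc α n * (poch β n / poch γ n)| * x^n) := by
        rw [abs_mul (bc α n)]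
        apply mul_le_mul_of_nonneg_right _ this
        simp only [abs_mul, abs_div] at hn
        exact hn.le
    

lemma bc_summable (α x : ℝ) (hx0 : 0 ≤ x) (hx : x < 1) :
    Summable (fun n => |bc α n| * x ^ n) := by
  have h := hyp_summable α 1 1 x hx0 hx
  refine h.congr fun n => ?_
  rw [div_self (by rw [poch_one]; exact fac_ne n), mul_one]

open MeasureTheory Set Filter Topology

/-- Endpoint singularities are integrable. -/
lemma intble_sing (l r α β : ℝ) (hlr : l < r) (hα : -1 < α) (hβ : -1 < β) :
    IntervalIntegrable (fun q => (q - l) ^ α * (r - q) ^ β) volume l r := by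
  set m := (l + r) / 2 with hm
  have h1 : l < m := by linarith
  have h2 : m < r := by linarith
  apply IntervalIntegrable.trans (b := m)
  · apply IntervalIntegrable.mul_continuousOn
    · have := (intervalIntegral.intervalIntegrable_rpow' (a := 0) (b := m - l) hα).comp_sub_right l
      simpa using this
    · rw [uIcc_of_le h1.le]
      apply ContinuousOn.rpow_const (by fun_prop)
      intro q hq; left; have := hq.2; linarith
  · apply IntervalIntegrable.continuousOn_mul
    · have := (intervalIntegral.intervalIntegrable_rpow' (a := r - m) (b := 0) hβ).comp_sub_left r
      simpa using this
    · rw [uIcc_of_le h2.le]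
      apply ContinuousOn.rpow_const (by fun_prop)
      intro q hq; left; have := hq.1; linarith

lemma beta_integral (α β : ℝ) (hα : 0 < α) (hβ : 0 < β) :
    ∫ q in (0:ℝ)..1, q ^ (α - 1) * (1 - q) ^ (β - 1) = Beta2 α β := by
  have h := ProbabilityTheory.beta_eq_betaIntegralReal α β hα hβ
  have h2 : Beta2 α β = ProbabilityTheory.beta α β := rfl
  rw [h2, h, Complex.betaIntegral]
  have : ∀ x ∈ uIcc (0:ℝ) 1, (x:ℂ) ^ ((α:ℂ) - 1) * (1 - (x:ℂ)) ^ ((β:ℂ) - 1)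
      = ((x ^ (α - 1) * (1 - x) ^ (β - 1) : ℝ) : ℂ) := by
    intro x hx
    rw [uIcc_of_le zero_le_one] at hx
    push_cast
    rw [Complex.ofReal_cpow hx.1, Complex.ofReal_cpow (by linarith [hx.2])]
    push_cast; rfl
  rw [intervalIntegral.integral_congr this, intervalIntegral.integral_ofReal, Complex.ofReal_re]

lemma Beta2_comm (α β : ℝ) : Beta2 α β = Beta2 β α := by
  unfold Beta2; rw [mul_comm, add_comm]

/-- recursion for Beta2, valid also at poles of the denominator -/
lemma Beta2_rec (α β : ℝ) (hβ : β ≠ 0) :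
    β * Beta2 α β = (β + α) * Beta2 α (β + 1) := by
  unfold Beta2
  rw [Real.Gamma_add_one hβ]
  by_cases h : α + β = 0
  · rw [h, Real.Gamma_zero, add_comm β α, h]; simp
  · rw [← add_assoc, Real.Gamma_add_one h]
    by_cases h3 : Real.Gamma (α + β) = 0
    · rw [h3]; simp
    · field_simp
      ring

/-- `K a γ z`: incomplete beta. -/
noncomputable def KK (a γ z : ℝ) : ℝ := ∫ q in z..1, q ^ (γ - 1) * (1 - q) ^ (a - 1)

noncomputable def SS (a γ z : ℝ) : ℝ := z ^ γ * ∑' k : ℕ, bc (1 - a) k * z ^ k / (γ + k)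

lemma intble_K (a γ z : ℝ) (ha : 0 < a) (hz : 0 < z) (hz1 : z ≤ 1) :
    IntervalIntegrable (fun q => q ^ (γ - 1) * (1 - q) ^ (a - 1)) volume z 1 := by
  apply IntervalIntegrable.continuousOn_mul
  · have := (intervalIntegral.intervalIntegrable_rpow' (a := 1 - z) (b := 0)
      (r := a - 1) (by linarith)).comp_sub_left 1
    simpa using this
  · rw [uIcc_of_le hz1]
    apply ContinuousOn.rpow_const (by fun_prop)
    intro q hq; left; have := hq.1; linarith

/-- lower bound of distance to integers -/
lemma dist_int (γ : ℝ) (h : ∀ m : ℤ, γ ≠ m) : ∃ c > 0, ∀ m : ℤ, c ≤ |γ + m| := by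
  have hf : Int.fract γ ≠ 0 := by
    intro h0
    apply h ⌊γ⌋
    have := Int.floor_add_fract γ
    linarith
  have h0 : 0 < Int.fract γ := lt_of_le_of_ne (Int.fract_nonneg γ) (Ne.symm hf)
  have h1 := Int.fract_lt_one γ
  refine ⟨min (Int.fract γ) (1 - Int.fract γ), by apply lt_min <;> linarith, fun m => ?_⟩
  have e : γ + m = Int.fract γ + ((⌊γ⌋ + m : ℤ) : ℝ) := by
    push_cast; have := Int.floor_add_fract γ; linarith
  rw [e]
  rcases le_or_gt 0 (⌊γ⌋ + m) with hm | hm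
  · have : (0:ℝ) ≤ ((⌊γ⌋ + m : ℤ) : ℝ) := by exact_mod_cast hm
    refine le_trans (min_le_left _ _) (le_trans ?_ (le_abs_self _))
    linarith
  · have : ((⌊γ⌋ + m : ℤ) : ℝ) ≤ -1 := by exact_mod_cast (by omega : ⌊γ⌋ + m ≤ -1)
    refine le_trans (min_le_right _ _) (le_trans ?_ (neg_le_abs _))
    linarith

lemma SS_summable (a γ z : ℝ) (hγ : ∀ m : ℤ, γ ≠ m) (hz : 0 ≤ z) (hz1 : z < 1) :
    Summable (fun k : ℕ => bc (1 - a) k * z ^ k / (γ + k)) := by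
  obtain ⟨c, hc, h⟩ := dist_int γ hγ
  apply Summable.of_norm_bounded (g := fun k => |bc (1-a) k| * z ^ k * c⁻¹)
    ((bc_summable _ _ hz hz1).mul_right _)
  intro k
  rw [Real.norm_eq_abs, abs_div, abs_mul, abs_of_nonneg (pow_nonneg hz k), div_eq_mul_inv]
  gcongr
  exact_mod_cast h k

/-- For `γ > 0`. -/
lemma incbeta_pos (a γ z : ℝ) (ha : 0 < a) (hγ : 0 < γ) (hz : 0 < z) (hz1 : z < 1) :
    KK a γ z + SS a γ z = Beta2 a γ := by
  have h01 : IntervalIntegrable (fun q : ℝ => q ^ (γ - 1) * (1 - q) ^ (a - 1)) volume 0 1 := by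
    simpa using intble_sing 0 1 (γ-1) (a-1) one_pos (by linarith) (by linarith)
  have hadd := intervalIntegral.integral_add_adjacent_intervals (a := 0) (b := z) (c := 1)
    (f := fun q : ℝ => q ^ (γ - 1) * (1 - q) ^ (a - 1)) (μ := volume)
    (h01.mono_set (by rw [uIcc_of_le hz.le, uIcc_of_le zero_le_one]; exact Icc_subset_Icc_right hz1.le))
    (intble_K a γ z ha hz hz1.le)
  rw [beta_integral γ a hγ ha] at hadd
  have hsum : HasSum (fun k : ℕ => ∫ q in (0:ℝ)..z, q ^ (γ - 1) * (bc (1 - a) k * q ^ k))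
      (∫ q in (0:ℝ)..z, q ^ (γ - 1) * (1 - q) ^ (a - 1)) := by
    apply intervalIntegral.hasSum_integral_of_dominated_convergence
      (fun k q => |bc (1 - a) k| * z ^ k * q ^ (γ - 1))
    · intro n
      apply Measurable.aestronglyMeasurable
      fun_prop
    · intro n
      filter_upwards with q hq
      rw [uIoc_of_le hz.le] at hq
      rw [norm_mul, norm_mul, Real.norm_eq_abs, Real.norm_eq_abs, Real.norm_eq_abs,
        abs_of_nonneg (Real.rpow_nonneg hq.1.le _), abs_of_nonneg (pow_nonneg hq.1.le _), mul_comm]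
      have := Real.rpow_nonneg hq.1.le (γ - 1)
      have := hq.1.le
      have := hq.2
      gcongr
    · filter_upwards with q hq
      exact (bc_summable _ _ hz.le hz1).mul_right _
    · simp_rw [tsum_mul_right]
      apply IntervalIntegrable.const_mul
      exact intervalIntegral.intervalIntegrable_rpow' (by linarith)
    · filter_upwards with q hq
      rw [uIoc_of_le hz.le] at hq
      have := binom_hasSum (1 - a) q (by rw [abs_of_pos hq.1]; linarith [hq.2])
      rw [neg_sub] at this
      exact this.mul_left _
  have hterm : ∀ k : ℕ, ∫ q in (0:ℝ)..z, q ^ (γ - 1) * (bc (1 - a) k * q ^ k)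
      = z ^ γ * (bc (1 - a) k * z ^ k / (γ + k)) := by
    intro k
    have e : ∫ q in (0:ℝ)..z, q ^ (γ - 1) * (bc (1 - a) k * q ^ k)
        = ∫ q in (0:ℝ)..z, bc (1 - a) k * q ^ (γ - 1 + k) := by
      apply intervalIntegral.integral_congr_ae
      filter_upwards with q hq
      rw [uIoc_of_le hz.le] at hq
      rw [Real.rpow_add hq.1, Real.rpow_natCast]; ring
    have hk : (0:ℝ) ≤ k := k.cast_nonneg
    rw [e, intervalIntegral.integral_const_mul, integral_rpow (by left; linarith),
      show γ - 1 + k + 1 = γ + k by ring, Real.zero_rpow (by linarith), Real.rpow_add hz,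
      Real.rpow_natCast]
    ring
  simp_rw [hterm] at hsum
  have : SS a γ z = ∫ q in (0:ℝ)..z, q ^ (γ - 1) * (1 - q) ^ (a - 1) := by
    rw [← hsum.tsum_eq, tsum_mul_left]; rfl
  rw [this, Beta2_comm, ← hadd, KK, add_comm]

lemma KK_rec (a γ z : ℝ) (ha : 0 < a) (hz : 0 < z) (hz1 : z < 1) :
    γ * KK a γ z - (γ + a) * KK a (γ + 1) z = - (z ^ γ * (1 - z) ^ a) := by
  have hI1 := (intble_K a γ z ha hz hz1.le).const_mul γ
  have hI2 := (intble_K a (γ+1) z ha hz hz1.le).const_mul (γ + a)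
  have hF := intervalIntegral.integral_eq_sub_of_hasDerivAt_of_le (a := z) (b := 1)
    (f := fun q : ℝ => q ^ γ * (1 - q) ^ a)
    (f' := fun q => γ * (q ^ (γ - 1) * (1 - q) ^ (a - 1)) -
      (γ + a) * (q ^ (γ + 1 - 1) * (1 - q) ^ (a - 1))) hz1.le ?_ ?_ (hI1.sub hI2)
  · rw [intervalIntegral.integral_sub hI1 hI2, intervalIntegral.integral_const_mul,
      intervalIntegral.integral_const_mul] at hF
    simp only [KK]
    rw [hF]
    simp [ha.ne']
  · apply ContinuousOn.mul
    · apply ContinuousOn.rpow_const (by fun_prop)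
      intro q hq; left; have := hq.1; linarith
    · apply ContinuousOn.rpow_const (by fun_prop)
      intro q hq; right; exact ha.le
  · intro q hq
    have hq0 : 0 < q := hz.trans hq.1
    have hq1 : 0 < 1 - q := by linarith [hq.2]
    have d1 := Real.hasDerivAt_rpow_const (x := q) (p := γ) (Or.inl hq0.ne')
    have d2 := ((hasDerivAt_id q).const_sub 1).rpow_const (p := a) (Or.inl hq1.ne')
    have d3 := d1.mul d2
    refine HasDerivAt.congr_deriv d3 ?_
    simp only [id_eq]
    rw [show γ + 1 - 1 = (γ - 1) + 1 by ring, Real.rpow_add_one hq0.ne',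
      show q ^ γ = q ^ (γ - 1) * q by rw [← Real.rpow_add_one hq0.ne']; congr 1; ring,
      show (1-q) ^ a = (1-q) ^ (a - 1) * (1-q) by rw [← Real.rpow_add_one hq1.ne']; congr 1; ring]
    ring

lemma SS_rec (a γ z : ℝ) (hγ : ∀ m : ℤ, γ ≠ m) (hz : 0 < z) (hz1 : z < 1) :
    γ * SS a γ z - (γ + a) * SS a (γ + 1) z = z ^ γ * (1 - z) ^ a := by
  have hne : ∀ k : ℕ, γ + k ≠ 0 := by
    intro k hk
    apply hγ (-(k:ℤ)); push_cast; linarith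
  have s1 := SS_summable a γ z hγ hz.le hz1
  have s2 := SS_summable a (γ+1) z (fun m hm => hγ (m - 1) (by push_cast; linarith)) hz.le hz1
  have hb := (binom_hasSum (-a) z (by rwa [abs_of_pos hz]))
  rw [neg_neg] at hb
  have h1 : ∑' k : ℕ, bc (1 - a) k * z ^ k / (γ + k) = 1 / γ +
      ∑' k : ℕ, bc (1 - a) (k+1) * z ^ (k+1) / (γ + (k+1 : ℕ)) := by
    rw [s1.tsum_eq_zero_add]; simp [bc_zero]
  have h2 : (1 - z) ^ a = 1 + ∑' k : ℕ, bc (-a) (k+1) * z ^ (k+1) := by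
    rw [← hb.tsum_eq, hb.summable.tsum_eq_zero_add]; simp [bc_zero]
  have s1' := (summable_nat_add_iff 1).mpr s1
  have key : ∑' k : ℕ, bc (-a) (k+1) * z ^ (k+1) =
      γ * (∑' k : ℕ, bc (1 - a) (k+1) * z ^ (k+1) / (γ + (k+1 : ℕ))) -
      (γ + a) * z * (∑' k : ℕ, bc (1 - a) k * z ^ k / (γ + 1 + k)) := by
    rw [← tsum_mul_left, ← tsum_mul_left, ← Summable.tsum_sub (s1'.mul_left _) (s2.mul_left _)]
    apply tsum_congr
    intro k
    rw [show -a = (1 - a) - 1 by ring, bc_pascal, bc_succ]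
    have := hne (k+1)
    push_cast at this ⊢
    rw [show γ + 1 + (k:ℝ) = γ + (k + 1) by ring, pow_succ]
    field_simp
    ring
  unfold SS
  have hγ0 : γ ≠ 0 := by simpa using hne 0
  rw [h2, key, h1, Real.rpow_add_one hz.ne']
  field_simp
  ring

lemma incbeta (a γ z : ℝ) (ha : 0 < a) (hγ : ∀ m : ℤ, γ ≠ m) (hz : 0 < z) (hz1 : z < 1) :
    KK a γ z + SS a γ z = Beta2 a γ := by
  obtain ⟨N, hN⟩ := exists_nat_gt (-γ)
  induction N generalizing γ with
  | zero => exact incbeta_pos a γ z ha (by simpa using hN) hz hz1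
  | succ N ih =>
    have hγ' : ∀ m : ℤ, γ + 1 ≠ m := fun m hm => hγ (m - 1) (by push_cast; linarith)
    have h := ih (γ + 1) hγ' (by push_cast at hN; linarith)
    have h1 := KK_rec a γ z ha hz hz1
    have h2 := SS_rec a γ z hγ hz hz1
    have hγ0 : γ ≠ 0 := by simpa using hγ 0
    have h3 := Beta2_rec a γ hγ0
    apply mul_left_cancel₀ hγ0
    rw [h3, ← h]
    linarith

lemma bc_pos (e : ℝ) (he : 0 < e) (n : ℕ) : 0 < bc e n := by
  induction n with
  | zero => rw [bc_zero]; norm_num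
  | succ n ih => rw [bc_succ]; positivity

lemma bc_bound (e : ℝ) (he : e < 1) :
    ∃ e' C : ℝ, 0 < e' ∧ e' < 1 ∧ 0 ≤ C ∧ ∀ n, |bc e n| ≤ C * bc e' n := by
  obtain ⟨N, hN⟩ := exists_nat_gt (-e)
  set e' := max e (1/2) with he'
  have hp : 0 < e' := lt_of_lt_of_le (by norm_num) (le_max_right _ _)
  have hle : e ≤ e' := le_max_left _ _
  set C := ∑ i ∈ Finset.range (N+1), |bc e i| / bc e' i with hC
  have hnn : ∀ i, 0 ≤ |bc e i| / bc e' i := fun i =>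
    div_nonneg (abs_nonneg _) (bc_pos e' hp i).le
  have hsmall : ∀ n ≤ N, |bc e n| ≤ C * bc e' n := by
    intro n hn
    rw [← div_le_iff₀ (bc_pos e' hp n)]
    exact Finset.single_le_sum (f := fun i => |bc e i| / bc e' i) (fun i _ => hnn i)
      (Finset.mem_range.mpr (by omega))
  refine ⟨e', C, hp, max_lt he (by norm_num), Finset.sum_nonneg fun i _ => hnn i, ?_⟩
  intro n
  rcases le_total n N with h | h
  · exact hsmall n h
  · induction n, h using Nat.le_induction with
    | base => exact hsmall N le_rfl
    | succ n hn ih =>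
      have hn' : (N:ℝ) ≤ n := by exact_mod_cast hn
      rw [bc_succ, bc_succ, abs_mul, ← mul_assoc, abs_of_nonneg (a := (e + n) / (n+1))
        (div_nonneg (by linarith) (by positivity))]
      have := (bc_pos e' hp n).le
      have := abs_nonneg (bc e n)
      apply mul_le_mul ih _ (div_nonneg (by linarith) (by positivity)) (by linarith)
      gcongr

lemma bc_div_summable (e : ℝ) (h0 : 0 < e) (h1 : e < 1) :
    Summable (fun n : ℕ => bc e n / (n + 1)) := by
  apply summable_of_sum_range_le (c := 1 / (1 - e))
  · intro n; have := bc_pos e h0 n; positivity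
  · intro n
    have : ∑ i ∈ Finset.range n, bc e i / (i + 1) = (1 - bc e n) / (1 - e) := by
      have h1' : 1 - e ≠ 0 := by linarith
      induction n with
      | zero => simp [bc_zero]
      | succ n ih =>
        rw [Finset.sum_range_succ, ih, bc_succ]
        field_simp
        ring
    rw [this]
    have := bc_pos e h0 n
    have : 0 < 1 - e := by linarith
    gcongr
    linarith

lemma bc_abs_div_summable (e : ℝ) (h1 : e < 1) :
    Summable (fun n : ℕ => |bc e n| / (n + 1)) := by
  obtain ⟨e', C, h0', h1', hC, h⟩ := bc_bound e h1
  apply Summable.of_nonneg_of_le (fun n => by positivity) _ ((bc_div_summable e' h0' h1').mul_left C)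
  intro n
  rw [← mul_div_assoc]
  have := h n
  gcongr

/-- uniform bound of reciprocal -/
lemma recip_bound (γ : ℝ) (h : ∀ m : ℤ, γ ≠ m) :
    ∃ M ≥ 0, ∀ n k : ℕ, |γ + n - k|⁻¹ ≤ M * (k + 1) / (n + 1) := by
  obtain ⟨c, hc, hd⟩ := dist_int γ h
  refine ⟨1 + (|γ| + 1) / c, by positivity, fun n k => ?_⟩
  have h1 : c ≤ |γ + n - k| := by
    have := hd (n - k); push_cast at this; rwa [← add_sub_assoc] at this
  have hpos : 0 < |γ + n - k| := hc.trans_le h1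
  rw [inv_le_iff_one_le_mul₀ hpos]
  rw [div_mul_eq_mul_div, le_div_iff₀ (by positivity), one_mul]
  have h2 : (n:ℝ) - k ≤ |γ + n - k| + |γ| := by
    have := le_abs_self (γ + n - k); have := neg_abs_le γ; linarith
  have h3 : (|γ| + 1) ≤ (|γ| + 1) / c * |γ + n - k| := by
    rw [div_mul_eq_mul_div, le_div_iff₀ hc]; gcongr
  set X := |γ + n - k|
  set Y := (|γ| + 1) / c * X
  have hg := abs_nonneg γ
  have hk : (0:ℝ) ≤ k := k.cast_nonneg
  have e : (1 + (|γ| + 1) / c) * (k + 1) * X = (X + Y) * (k + 1) := by simp only [Y]; ring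
  rw [e]
  have : 0 ≤ X * k := by positivity
  nlinarith [mul_nonneg hk (by linarith : (0:ℝ) ≤ Y - 1)]

lemma L2_summable (e δ : ℝ) (he : e < 1) (hδ : ∀ m : ℤ, δ ≠ m) :
    Summable (fun n : ℕ => |bc e n / (δ + n)|) := by
  obtain ⟨M, hM, h⟩ := recip_bound δ hδ
  apply Summable.of_nonneg_of_le (fun n => abs_nonneg _) _ ((bc_abs_div_summable e he).mul_left M)
  intro n
  have := h n 0
  simp only [Nat.cast_zero, sub_zero, zero_add, mul_one] at this
  rw [abs_div, div_eq_mul_inv]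
  calc |bc e n| * |δ + n|⁻¹ ≤ |bc e n| * (M / (n+1)) := by gcongr
    _ = _ := by ring

lemma L2 (e δ : ℝ) (he : e < 1) (hδ : ∀ m : ℤ, δ ≠ m) :
    ∑' n : ℕ, bc e n / (δ + n) = Beta2 (1 - e) δ := by
  have ha : 0 < 1 - e := by linarith
  have hcont : ContinuousOn (fun z : ℝ => ∑' k : ℕ, bc e k * z ^ k / (δ + k)) (Icc (1/2) 1) := by
    apply continuousOn_tsum (u := fun k : ℕ => |bc e k / (δ + k)|)
    · intro k; fun_prop
    · exact L2_summable e δ he hδ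
    · intro k z hz
      have hz0 : 0 ≤ z := by linarith [hz.1]
      rw [Real.norm_eq_abs, mul_div_right_comm, abs_mul]
      apply mul_le_of_le_one_right (abs_nonneg _)
      rw [abs_of_nonneg (pow_nonneg hz0 k)]
      exact pow_le_one₀ hz0 hz.2
  have hS : ContinuousOn (fun z => SS (1 - e) δ z) (Icc (1/2) 1) := by
    unfold SS
    rw [sub_sub_cancel]
    apply ContinuousOn.mul _ hcont
    apply ContinuousOn.rpow_const (by fun_prop)
    intro q hq; left; have := hq.1; linarith
  have hK : ContinuousOn (fun z => KK (1 - e) δ z) (Icc (1/2) 1) := by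
    have h := intervalIntegral.continuousOn_primitive_interval_left (a := 1/2) (b := 1)
      (f := fun q => q ^ (δ - 1) * (1 - q) ^ (1 - e - 1)) (μ := volume)
      (by
        have := intble_K (1 - e) δ (1/2) ha (by norm_num) (by norm_num)
        rw [intervalIntegrable_iff_integrableOn_Icc_of_le (by norm_num)] at this
        rwa [uIcc_of_le (by norm_num)])
    rwa [uIcc_of_le (by norm_num)] at h
  have hT := (hK.add hS).continuousWithinAt (right_mem_Icc.mpr (by norm_num : (1/2:ℝ) ≤ 1))
  have hT2 : Tendsto (fun z => KK (1 - e) δ z + SS (1 - e) δ z) (𝓝[Ico (1/2) 1] 1)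
      (𝓝 (KK (1 - e) δ 1 + SS (1 - e) δ 1)) :=
    hT.mono_left (nhdsWithin_mono _ Ico_subset_Icc_self)
  have hne : (𝓝[Ico (1/2:ℝ) 1] 1).NeBot := by
    rw [nhdsWithin_Ico_eq_nhdsLT (by norm_num)]; infer_instance
  have hT3 : Tendsto (fun z => KK (1 - e) δ z + SS (1 - e) δ z) (𝓝[Ico (1/2) 1] 1)
      (𝓝 (Beta2 (1 - e) δ)) := by
    apply tendsto_const_nhds.congr'
    filter_upwards [self_mem_nhdsWithin] with z hz
    exact (incbeta (1 - e) δ z ha hδ (by linarith [hz.1]) hz.2).symm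
  have := tendsto_nhds_unique hT2 hT3
  rw [← this]
  simp [KK, SS]

noncomputable def GG (a c e z : ℝ) : ℝ :=
  ∫ q in z..1, (1 - q) ^ (a - 1) * q ^ (c - 1) * (q - z) ^ (-e)

lemma Beta2_shift_right (α γ : ℝ) (hγ : ∀ m : ℤ, γ ≠ m) (n : ℕ) :
    Beta2 α (γ - n) = Beta2 α γ * (poch (1 - α - γ) n / poch (1 - γ) n) := by
  induction n with
  | zero => simp [poch]
  | succ n ih =>
    have h1 : γ - (n + 1) ≠ 0 := fun h => hγ (n+1) (by push_cast; linarith)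
    have h2 : 1 - γ + n ≠ 0 := fun h => hγ (n+1) (by push_cast; linarith)
    have hr := Beta2_rec α (γ - (n+1)) h1
    rw [show γ - (n + 1 : ℝ) + 1 = γ - n by ring, ih] at hr
    push_cast
    apply mul_left_cancel₀ h1
    rw [hr, poch_succ, poch_succ]
    have h3 : poch (1 - γ) n ≠ 0 := by
      apply poch_ne_zero
      intro m h; exact hγ (m+1) (by push_cast; linarith)
    field_simp
    ring

/-- expansion of G into incomplete betas -/
lemma GG_hasSum (a c e z : ℝ) (ha : 0 < a) (he : e < 1) (hz : 0 < z) (hz1 : z < 1) :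
    HasSum (fun n : ℕ => bc e n * z ^ n * KK a (c - e - n) z) (GG a c e z) := by
  obtain ⟨e', C, h0', h1', hC, hb⟩ := bc_bound e he
  have hr : ∀ q ∈ Ioo z 1, |z / q| < 1 := by
    intro q hq
    have : 0 < q := hz.trans hq.1
    rw [abs_of_pos (by positivity), div_lt_one this]; exact hq.1
  have hae : ∀ᵐ q ∂(volume : Measure ℝ), q ∈ uIoc z 1 → q ∈ Ioo z 1 := by
    have : ∀ᵐ q ∂(volume : Measure ℝ), q ≠ 1 := by
      simp [ae_iff, measure_singleton]
    filter_upwards [this] with q hq1 hq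
    rw [uIoc_of_le hz1.le] at hq
    exact ⟨hq.1, lt_of_le_of_ne hq.2 hq1⟩
  have key : HasSum (fun n : ℕ => ∫ q in z..1, bc e n * (z / q) ^ n *
      (q ^ (c - e - 1) * (1 - q) ^ (a - 1))) (GG a c e z) := by
    unfold GG
    apply intervalIntegral.hasSum_integral_of_dominated_convergence
      (fun n q => bc e' n * (z / q) ^ n * (C * (q ^ (c - e - 1) * (1 - q) ^ (a - 1))))
    · intro n
      apply Measurable.aestronglyMeasurable
      fun_prop
    · intro n
      filter_upwards [hae] with q hq' hqq
      have hq := hq' hqq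
      have hq0 : 0 < q := hz.trans hq.1
      have hq1 : 0 < 1 - q := by linarith [hq.2]
      have p1 := Real.rpow_pos_of_pos hq0 (c - e - 1)
      have p2 := Real.rpow_pos_of_pos hq1 (a - 1)
      rw [norm_mul, norm_mul, Real.norm_eq_abs, Real.norm_eq_abs, Real.norm_eq_abs,
        abs_of_pos (mul_pos p1 p2), abs_of_pos (a := (z/q)^n) (by positivity)]
      calc _ ≤ (C * bc e' n) * (z / q) ^ n * (q ^ (c - e - 1) * (1 - q) ^ (a - 1)) := by
            gcongr; exact hb n
        _ = _ := by ring
    · filter_upwards [hae] with q hq' hqq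
      exact (binom_hasSum e' (z/q) (hr q (hq' hqq))).summable.mul_right _
    · have hint : IntervalIntegrable (fun q => C * q ^ (c - e - 1 + e') *
          ((q - z) ^ (-e') * (1 - q) ^ (a - 1))) volume z 1 := by
        apply IntervalIntegrable.continuousOn_mul (intble_sing z 1 _ _ hz1 (by linarith) (by linarith))
        apply ContinuousOn.mul (by fun_prop)
        apply ContinuousOn.rpow_const (by fun_prop)
        rw [uIcc_of_le hz1.le]
        intro q hq; left; have := hq.1; linarith
      refine hint.congr_ae ?_
      rw [Filter.EventuallyEq, ae_restrict_iff' measurableSet_uIoc]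
      filter_upwards [hae] with q hq' hqq
      have hq := hq' hqq
      have hq0 : 0 < q := hz.trans hq.1
      have h1 : 0 < q - z := by linarith [hq.1]
      rw [tsum_mul_right, (binom_hasSum e' (z/q) (hr q hq)).tsum_eq,
        show 1 - z / q = (q - z) / q by field_simp, Real.div_rpow h1.le hq0.le,
        Real.rpow_add hq0, Real.rpow_neg hq0.le]
      field_simp
    · filter_upwards [hae] with q hq' hqq
      have hq := hq' hqq
      have hq0 : 0 < q := hz.trans hq.1
      have h1 : 0 < q - z := by linarith [hq.1]
      have h := (binom_hasSum e (z/q) (hr q hq)).mul_right (q ^ (c - e - 1) * (1 - q) ^ (a - 1))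
      suffices hE : (1 - q) ^ (a - 1) * q ^ (c - 1) * (q - z) ^ (-e) =
          (1 - z / q) ^ (-e) * (q ^ (c - e - 1) * (1 - q) ^ (a - 1)) by
        rw [hE]; exact h
      rw [show 1 - z / q = (q - z) / q by field_simp, Real.div_rpow h1.le hq0.le,
        show c - 1 = (c - e - 1) + e by ring, Real.rpow_add hq0, Real.rpow_neg hq0.le]
      field_simp
  refine (congrArg (fun f => HasSum f (GG a c e z)) (funext fun n => ?_)).mpr key
  rw [KK, ← intervalIntegral.integral_const_mul]
  apply intervalIntegral.integral_congr_ae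
  filter_upwards [hae] with q hq' hqq
  have hq := hq' hqq
  have hq0 : 0 < q := hz.trans hq.1
  rw [show c - e - n - 1 = (c - e - 1) - n by ring, Real.rpow_sub hq0, Real.rpow_natCast, div_pow]
  field_simp

noncomputable def C1 (a c e : ℝ) (n : ℕ) : ℝ := bc e n * (poch (e - a - c + 1) n / poch (e - c + 1) n)
noncomputable def C2 (a c e : ℝ) (n : ℕ) : ℝ := bc (1 - a) n * (poch c n / poch (c - e + 1) n)

lemma double_summable (a c e z : ℝ) (he : e < 1) (hn : ∀ m : ℤ, e - c ≠ m)
    (hz : 0 < z) (hz1 : z < 1) :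
    Summable (fun p : ℕ × ℕ =>
      - (bc e p.1 * bc (1 - a) p.2 * z ^ p.2 / (c - e - p.1 + p.2))) := by
  obtain ⟨M, hM, hMb⟩ := recip_bound (e - c) hn
  have hk : Summable (fun k : ℕ => |bc (1 - a) k| * z ^ k * (k + 1)) := by
    have h := hyp_summable (1 - a) 2 1 z hz.le hz1
    refine h.congr fun k => ?_
    have : poch 2 k / poch 1 k = k + 1 := by
      rw [poch_one, div_eq_iff (fac_ne k)]
      induction k with
      | zero => simp [poch]
      | succ k ih => rw [poch_succ, ih, Nat.factorial_succ]; push_cast; ring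
    rw [this, abs_mul, abs_of_nonneg (a := (k:ℝ) + 1) (by positivity)]; ring
  have hp := ((bc_abs_div_summable e he).mul_of_nonneg hk (fun n => by positivity)
    (fun k => by positivity)).mul_left M
  apply Summable.of_norm_bounded hp
  rintro ⟨n, k⟩
  have h := hMb n k
  simp only
  rw [norm_neg, norm_div, norm_mul, norm_mul, norm_pow, Real.norm_eq_abs, Real.norm_eq_abs,
    Real.norm_eq_abs, Real.norm_eq_abs, abs_of_pos hz, div_eq_mul_inv,
    show c - e - n + k = -(e - c + n - k) by ring, abs_neg]
  calc _ ≤ |bc e n| * |bc (1 - a) k| * z ^ k * (M * (k + 1) / (n + 1)) := by gcongr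
    _ = _ := by ring

/-- the connection formula -/
lemma GG_formula (a c e z : ℝ) (ha : 0 < a) (he : e < 1) (hn : ∀ m : ℤ, e - c ≠ m)
    (hz : 0 < z) (hz1 : z < 1) :
    GG a c e z = Beta2 a (c - e) * ∑' n, C1 a c e n * z ^ n
      + z ^ (c - e) * (Beta2 (1 - e) (e - c) * ∑' n, C2 a c e n * z ^ n) := by
  have hn' : ∀ m : ℤ, c - e ≠ m := fun m h => hn (-m) (by push_cast; linarith)
  have hnn : ∀ (n : ℕ) (m : ℤ), c - e - n ≠ m := fun n m h => hn' (m + n) (by push_cast; linarith)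
  have hG := GG_hasSum a c e z ha he hz hz1
  have e1 : ∀ n : ℕ, bc e n * z ^ n * KK a (c - e - n) z =
      Beta2 a (c - e) * (C1 a c e n * z ^ n) +
      z ^ (c - e) * ∑' k : ℕ, - (bc e n * bc (1 - a) k * z ^ k / (c - e - n + k)) := by
    intro n
    have h1 := incbeta a (c - e - n) z ha (hnn n) hz hz1
    rw [Beta2_shift_right a (c - e) hn'] at h1
    have h2 : KK a (c - e - n) z = Beta2 a (c - e) * (poch (e - a - c + 1) n / poch (e - c + 1) n)
        - SS a (c - e - n) z := by
      rw [show e - a - c + 1 = 1 - a - (c - e) by ring, show e - c + 1 = 1 - (c - e) by ring]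
      linarith
    rw [h2, SS, Real.rpow_sub hz, Real.rpow_natCast]
    have h3 : ∑' k : ℕ, - (bc e n * bc (1 - a) k * z ^ k / (c - e - n + k))
        = - bc e n * ∑' k : ℕ, bc (1 - a) k * z ^ k / (c - e - n + k) := by
      rw [← tsum_mul_left]; congr 1; ext k; ring
    rw [h3, C1]
    have : z ^ n ≠ 0 := by positivity
    field_simp
    ring
  have sC1 : Summable fun n => C1 a c e n * z ^ n := by
    have := hyp_summable e (e - a - c + 1) (e - c + 1) z hz.le hz1
    apply Summable.of_norm
    refine this.congr fun n => ?_
    rw [C1, norm_mul, Real.norm_eq_abs, norm_pow, Real.norm_eq_abs, abs_of_pos hz]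
  have hdouble := double_summable a c e z he hn hz hz1
  have hS2 : Summable fun n : ℕ => ∑' k : ℕ, - (bc e n * bc (1 - a) k * z ^ k / (c - e - n + k)) :=
    hdouble.prod
  rw [← hG.tsum_eq, tsum_congr e1, Summable.tsum_add (sC1.mul_left _) (hS2.mul_left _),
    tsum_mul_left, tsum_mul_left]
  congr 2
  have hcomm := Summable.tsum_comm (f := fun n k : ℕ =>
    - (bc e n * bc (1 - a) k * z ^ k / (c - e - n + k))) hdouble
  rw [← hcomm, ← tsum_mul_left]
  apply tsum_congr
  intro k
  have hdk : ∀ m : ℤ, e - c - k ≠ m := fun m h => hn (m + k) (by push_cast; linarith)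
  have e2 : ∀ n : ℕ, -(bc e n * bc (1 - a) k * z ^ k / (c - e - n + k)) =
      bc (1 - a) k * z ^ k * (bc e n / (e - c - k + n)) := by
    intro n
    rw [show c - e - n + k = -(e - c - k + n) by ring, div_neg, neg_neg]; ring
  rw [tsum_congr e2, tsum_mul_left, L2 e _ he hdk, Beta2_shift_right _ _ hn, C2,
    show 1 - (1 - e) - (e - c) = c by ring, show 1 - (e - c) = c - e + 1 by ring]
  ring

lemma Beta2_shift (α β : ℝ) (hα : 0 < α) (hβ : 0 < β) (n : ℕ) :
    Beta2 α (β + n) = Beta2 α β * (poch β n / poch (α + β) n) := by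
  induction n with
  | zero => simp [poch]
  | succ n ih =>
    have h1 : β + n ≠ 0 := by positivity
    have h2 : α + β + n ≠ 0 := by positivity
    have h4 : β + n + α ≠ 0 := by positivity
    have hr := Beta2_rec α (β + n) h1
    rw [ih] at hr
    push_cast
    rw [← add_assoc]
    apply mul_left_cancel₀ h4
    rw [← hr, poch_succ, poch_succ]
    have h3 : poch (α + β) n ≠ 0 := poch_ne_zero _ (fun m => by positivity) _
    field_simp
    ring

lemma poch_add (a : ℝ) (i j : ℕ) : poch a (i + j) = poch a i * poch (a + i) j := by
  induction j with
  | zero => simp [poch]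
  | succ j ih => rw [← add_assoc, poch_succ, ih, poch_succ]; push_cast; ring

lemma Beta2_shift2 (μ d : ℝ) (hμ : 0 < μ) (hd : 0 < d) (i j : ℕ) :
    Beta2 (μ + i) (d + j) = Beta2 μ d * (poch μ i * poch d j / poch (μ + d) (i + j)) := by
  rw [Beta2_shift (μ + i) d (by positivity) hd, Beta2_comm (μ + i) d, Beta2_shift d μ hd hμ,
    Beta2_comm d μ, poch_add, add_comm d μ, show μ + i + d = μ + d + i by ring]
  rw [mul_assoc, div_mul_div_comm]

lemma pser_cont (C : ℕ → ℝ) (x : ℝ) (hx0 : 0 ≤ x) (hC : Summable fun i => |C i| * x ^ i) :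
    ContinuousOn (fun ρ : ℝ => ∑' i, C i * (x * ρ) ^ i) (Icc 0 1) := by
  apply continuousOn_tsum (u := fun i => |C i| * x ^ i)
  · intro k; fun_prop
  · exact hC
  · intro k z hz
    rw [norm_mul, Real.norm_eq_abs, norm_pow, Real.norm_eq_abs, abs_of_nonneg (mul_nonneg hx0 hz.1)]
    have := hz.1
    have : x * z ≤ x := mul_le_of_le_one_right hx0 hz.2
    gcongr

noncomputable def ff (C D : ℕ → ℝ) (x y μ d ρ : ℝ) : ℝ :=
  (ρ ^ (μ - 1) * (1 - ρ) ^ (d - 1)) *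
    ((∑' i, C i * (x * ρ) ^ i) * ∑' j, D j * (y * (1 - ρ)) ^ j)

lemma ff_intble (C D : ℕ → ℝ) (x y μ d : ℝ) (hx0 : 0 ≤ x) (hy0 : 0 ≤ y)
    (hC : Summable fun i => |C i| * x ^ i) (hD : Summable fun i => |D i| * y ^ i)
    (hμ : 0 < μ) (hd : 0 < d) :
    IntervalIntegrable (ff C D x y μ d) volume 0 1 := by
  unfold ff
  apply IntervalIntegrable.mul_continuousOn
  · simpa using intble_sing 0 1 (μ-1) (d-1) one_pos (by linarith) (by linarith)
  · rw [uIcc_of_le zero_le_one]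
    apply (pser_cont C x hx0 hC).mul
    have h := (pser_cont D y hy0 hD).comp (f := fun ρ : ℝ => 1 - ρ) (s := Icc 0 1) (by fun_prop)
      (by intro ρ hρ; exact ⟨by linarith [hρ.2], by linarith [hρ.1]⟩)
    exact h

lemma prod_hasSum (f g : ℕ → ℝ) (hf : Summable fun i => ‖f i‖) (hg : Summable fun i => ‖g i‖) :
    HasSum (fun p : ℕ × ℕ => f p.1 * g p.2) ((∑' i, f i) * ∑' j, g j) := by
  have h1 := summable_mul_of_summable_norm hf hg
  rw [tsum_mul_tsum_of_summable_norm hf hg]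
  exact h1.hasSum

lemma ff_hasSum (C D : ℕ → ℝ) (x y μ d : ℝ) (hx0 : 0 ≤ x) (hy0 : 0 ≤ y)
    (hC : Summable fun i => |C i| * x ^ i) (hD : Summable fun i => |D i| * y ^ i)
    (hμ : 0 < μ) (hd : 0 < d) :
    HasSum (fun p : ℕ × ℕ => C p.1 * D p.2 * x ^ p.1 * y ^ p.2 * Beta2 (μ + p.1) (d + p.2))
      (∫ ρ in (0:ℝ)..1, ff C D x y μ d ρ) := by
  have hae : ∀ᵐ q ∂(volume : Measure ℝ), q ∈ uIoc (0:ℝ) 1 → q ∈ Ioo (0:ℝ) 1 := by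
    have : ∀ᵐ q ∂(volume : Measure ℝ), q ≠ 1 := by
      simp [ae_iff, measure_singleton]
    filter_upwards [this] with q hq1 hq
    rw [uIoc_of_le zero_le_one] at hq
    exact ⟨hq.1, lt_of_le_of_ne hq.2 hq1⟩
  have hCD : Summable fun p : ℕ × ℕ => (|C p.1| * x ^ p.1) * (|D p.2| * y ^ p.2) :=
    hC.mul_of_nonneg hD (fun i => by positivity) (fun j => by positivity)
  have key : HasSum (fun p : ℕ × ℕ => ∫ ρ in (0:ℝ)..1, (ρ ^ (μ - 1) * (1 - ρ) ^ (d - 1)) *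
      ((C p.1 * (x * ρ) ^ p.1) * (D p.2 * (y * (1 - ρ)) ^ p.2)))
      (∫ ρ in (0:ℝ)..1, ff C D x y μ d ρ) := by
    apply intervalIntegral.hasSum_integral_of_dominated_convergence
      (fun p ρ => (|C p.1| * x ^ p.1) * (|D p.2| * y ^ p.2) * (ρ ^ (μ - 1) * (1 - ρ) ^ (d - 1)))
    · intro n
      apply Measurable.aestronglyMeasurable
      fun_prop
    · rintro ⟨i, j⟩
      filter_upwards [hae] with q hq' hqq
      have hq := hq' hqq
      have hq0 : 0 < q := hq.1
      have hq1 : 0 < 1 - q := by linarith [hq.2]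
      have p1 := Real.rpow_pos_of_pos hq0 (μ - 1)
      have p2 := Real.rpow_pos_of_pos hq1 (d - 1)
      simp only [Real.norm_eq_abs, abs_mul]
      rw [abs_of_pos p1, abs_of_pos p2, abs_of_nonneg (a := (x * q)^i) (by positivity),
        abs_of_nonneg (a := (y * (1 - q))^j) (by positivity), mul_comm]
      have h1 : x * q ≤ x := mul_le_of_le_one_right hx0 hq.2.le
      have h2 : y * (1 - q) ≤ y := mul_le_of_le_one_right hy0 (by linarith)
      gcongr
    · filter_upwards with q hq
      exact hCD.mul_right _
    · simp_rw [tsum_mul_right]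
      apply IntervalIntegrable.const_mul
      simpa using intble_sing 0 1 (μ-1) (d-1) one_pos (by linarith) (by linarith)
    · filter_upwards [hae] with q hq' hqq
      have hq := hq' hqq
      have hq0 : 0 < q := hq.1
      have hq1 : 0 < 1 - q := by linarith [hq.2]
      have aux : ∀ (E : ℕ → ℝ) (w r : ℝ), 0 ≤ w → 0 ≤ r → r ≤ 1 →
          (Summable fun i => |E i| * w ^ i) → Summable fun i => ‖E i * (w * r) ^ i‖ := by
        intro E w r hw hr hr1 hE
        apply Summable.of_nonneg_of_le (fun i => norm_nonneg _) _ hE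
        intro i
        rw [norm_mul, Real.norm_eq_abs, Real.norm_eq_abs, abs_of_nonneg (a := (w * r)^i) (by positivity)]
        have h1 : w * r ≤ w := mul_le_of_le_one_right hw hr1
        gcongr
      have a1 := aux C x q hx0 hq0.le hq.2.le hC
      have a2 := aux D y (1 - q) hy0 hq1.le (by linarith) hD
      have hm := prod_hasSum _ _ a1 a2
      exact hm.mul_left (q ^ (μ - 1) * (1 - q) ^ (d - 1))
  refine (congrArg (fun f => HasSum f (∫ ρ in (0:ℝ)..1, ff C D x y μ d ρ))
    (funext fun p => ?_)).mpr key
  obtain ⟨i, j⟩ := p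
  simp only
  rw [← beta_integral (μ + i) (d + j) (by positivity) (by positivity),
    ← intervalIntegral.integral_const_mul]
  apply intervalIntegral.integral_congr_ae
  filter_upwards [hae] with q hq' hqq
  have hq := hq' hqq
  have hq0 : 0 < q := hq.1
  have hq1 : 0 < 1 - q := by linarith [hq.2]
  rw [show μ + i - 1 = μ - 1 + i by ring, show d + j - 1 = d - 1 + j by ring, Real.rpow_add hq0,
    Real.rpow_add hq1, Real.rpow_natCast, Real.rpow_natCast, mul_pow, mul_pow]
  ring

lemma inner_eq (a c e s v : ℝ) (hs : 0 < s) (hv0 : 1 - s < v) (hv1 : v < 1) :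
    ∫ u in (0:ℝ)..(1 - v), u ^ (a - 1) * (s - u) ^ (c - 1) * (1 - u - v) ^ (-e)
      = s ^ (a + c - e - 1) * GG a c e ((v - (1 - s)) / s) := by
  set z := (v - (1 - s)) / s with hz
  have hz0 : 0 < z := div_pos (by linarith) hs
  have hz1 : z < 1 := by rw [hz, div_lt_one hs]; linarith
  have hsz : s * z = v - (1 - s) := by rw [hz]; field_simp
  have h := intervalIntegral.integral_comp_sub_mul (a := z) (b := 1)
    (fun u => u ^ (a - 1) * (s - u) ^ (c - 1) * (1 - u - v) ^ (-e)) hs.ne' s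
  rw [show s - s * 1 = 0 by ring, show s - s * z = 1 - v by rw [hsz]; ring, smul_eq_mul] at h
  have h2 : ∫ u in (0:ℝ)..(1 - v), u ^ (a - 1) * (s - u) ^ (c - 1) * (1 - u - v) ^ (-e)
      = s * ∫ q in z..1, (s - s * q) ^ (a - 1) * (s - (s - s * q)) ^ (c - 1) *
        (1 - (s - s * q) - v) ^ (-e) := by
    rw [h]; field_simp
  rw [h2, GG, ← intervalIntegral.integral_const_mul, ← intervalIntegral.integral_const_mul]
  apply intervalIntegral.integral_congr_ae
  filter_upwards with q hq
  rw [uIoc_of_le hz1.le] at hq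
  have e1 : s - s * q = s * (1 - q) := by ring
  have e2 : s - (s - s * q) = s * q := by ring
  have e3 : 1 - (s - s * q) - v = s * (q - z) := by rw [mul_sub, hsz]; ring
  rw [e2, e3, e1, Real.mul_rpow hs.le (by linarith [hq.2]), Real.mul_rpow hs.le (by linarith [hq.1]),
    Real.mul_rpow hs.le (by linarith [hq.1]),
    show a + c - e - 1 = 1 + (a - 1) + (c - 1) + (-e) by ring, Real.rpow_add hs, Real.rpow_add hs,
    Real.rpow_add hs, Real.rpow_one]
  ring

lemma F3t_eq (a b c d e x y : ℝ) (hd : 0 < d)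
    (hx0 : 0 ≤ x) (hy0 : 0 ≤ y) (hx1 : x < 1) (hy1 : y < 1) :
    ∫ ρ in (0:ℝ)..1, ff (C1 a c e) (bc (1 - b)) x y 1 d ρ
      = 1 / d * F3t 1 (1 - b) (e - a - c + 1) d (d + 1) e (e - c + 1) x y := by
  have h := ff_hasSum (C1 a c e) (bc (1 - b)) x y 1 d hx0 hy0
    (hyp_summable e (e - a - c + 1) (e - c + 1) x hx0 hx1) (bc_summable _ y hy0 hy1) one_pos hd
  rw [← h.tsum_eq, h.summable.tsum_prod, F3t, ← tsum_mul_left]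
  apply tsum_congr
  intro i
  rw [← tsum_mul_left]
  apply tsum_congr
  intro j
  simp only
  have hB : Beta2 1 d = 1 / d := by
    unfold Beta2
    rw [Real.Gamma_one, add_comm 1 d, Real.Gamma_add_one hd.ne']
    have := (Real.Gamma_pos_of_pos hd).ne'
    field_simp
  rw [Beta2_shift2 1 d one_pos hd, hB, C1, bc, bc, add_comm 1 d]
  simp only [div_eq_mul_inv, mul_inv]
  ring

lemma F3_eq (a b c d e x y : ℝ) (hd : 0 < d) (hce : 0 < c - e + 1)
    (hx0 : 0 ≤ x) (hy0 : 0 ≤ y) (hx1 : x < 1) (hy1 : y < 1) :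
    ∫ ρ in (0:ℝ)..1, ff (C2 a c e) (bc (1 - b)) x y (c - e + 1) d ρ
      = Beta2 d (1 - e + c) * F3 (1 - a) (1 - b) c d (c + d - e + 1) x y := by
  have h := ff_hasSum (C2 a c e) (bc (1 - b)) x y (c - e + 1) d hx0 hy0
    (hyp_summable (1 - a) c (c - e + 1) x hx0 hx1) (bc_summable _ y hy0 hy1) hce hd
  rw [← h.tsum_eq, h.summable.tsum_prod, F3, ← tsum_mul_left]
  apply tsum_congr
  intro i
  rw [← tsum_mul_left]
  apply tsum_congr
  intro j
  simp only
  have hp : poch (c - e + 1) i ≠ 0 := poch_ne_zero _ (fun m => by positivity) _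
  rw [Beta2_shift2 _ d hce hd, Beta2_comm d, C2, bc, bc, show 1 - e + c = c - e + 1 by ring,
    show c + d - e + 1 = c - e + 1 + d by ring]
  have hp2 : poch (c - e + 1) i * (poch (c - e + 1) i)⁻¹ = 1 := mul_inv_cancel₀ hp
  simp only [div_eq_mul_inv, mul_inv]
  linear_combination (poch (1 - a) i * (i.factorial:ℝ)⁻¹ * poch c i * poch (1 - b) j *
    (j.factorial:ℝ)⁻¹ * x ^ i * y ^ j * Beta2 (c - e + 1) d * poch d j *
    (poch (c - e + 1 + d) (i + j))⁻¹) * hp2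

/-- Evaluation of `I₆(s,t)` in terms of the extended `F₃` and `F₃`. -/
theorem stmt16 (a b c d e : ℝ) (ha : 0 < a) (hb : 0 < b) (hd : 0 < d)
    (he : e < 1) (hce : 0 < c - e + 1) (hnint : ∀ m : ℤ, e - c ≠ (m : ℝ))
    (s t : ℝ) (hs0 : 0 < s) (hs1 : s < 1) (ht0 : 1 - s < t) (ht1 : t < 1) :
    I6 a b c d e s t
      = (Beta2 a (c - e) / d) * s ^ (a + c - e - 1) * t ^ (b - 1) * (s + t - 1) ^ d *
          F3t 1 (1 - b) (e - a - c + 1) d (d + 1) e (e - c + 1)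
            ((s + t - 1) / s) ((s + t - 1) / t)
        + Beta2 (1 - e) (e - c) * Beta2 d (1 - e + c) * s ^ (a - 1) * t ^ (b - 1) *
          (s + t - 1) ^ (c + d - e) *
          F3 (1 - a) (1 - b) c d (c + d - e + 1) ((s + t - 1) / s) ((s + t - 1) / t) := by
  set p := s + t - 1 with hp
  have hp0 : 0 < p := by linarith
  have ht : 0 < t := by linarith
  set x := p / s with hx
  set y := p / t with hy
  have hx0 : 0 < x := div_pos hp0 hs0
  have hy0 : 0 < y := div_pos hp0 ht
  have hx1 : x < 1 := by rw [hx, div_lt_one hs0]; linarith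
  have hy1 : y < 1 := by rw [hy, div_lt_one ht]; linarith
  have hae : ∀ᵐ q ∂(volume : Measure ℝ), q ∈ uIoc (0:ℝ) 1 → q ∈ Ioo (0:ℝ) 1 := by
    have : ∀ᵐ q ∂(volume : Measure ℝ), q ≠ 1 := by
      simp [ae_iff, measure_singleton]
    filter_upwards [this] with q hq1 hq
    rw [uIoc_of_le zero_le_one] at hq
    exact ⟨hq.1, lt_of_le_of_ne hq.2 hq1⟩
  have hsub := intervalIntegral.integral_comp_add_mul (a := 0) (b := 1)
    (fun v => (∫ u in (0:ℝ)..(1 - v), u ^ (a - 1) * (s - u) ^ (c - 1) * (1 - u - v) ^ (-e)) *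
      v ^ (b - 1) * (t - v) ^ (d - 1)) hp0.ne' (1 - s)
  rw [show 1 - s + p * 0 = 1 - s by ring, show 1 - s + p * 1 = t by rw [hp]; ring, smul_eq_mul]
    at hsub
  have hI : I6 a b c d e s t = p * ∫ ρ in (0:ℝ)..1,
      (∫ u in (0:ℝ)..(1 - (1 - s + p * ρ)), u ^ (a - 1) * (s - u) ^ (c - 1) *
        (1 - u - (1 - s + p * ρ)) ^ (-e)) *
      (1 - s + p * ρ) ^ (b - 1) * (t - (1 - s + p * ρ)) ^ (d - 1) := by
    rw [hsub, I6]; field_simp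
  set K0 := s ^ (a + c - e - 1) * t ^ (b - 1) * p ^ (d - 1) with hK0
  have hJ : ∫ ρ in (0:ℝ)..1,
      (∫ u in (0:ℝ)..(1 - (1 - s + p * ρ)), u ^ (a - 1) * (s - u) ^ (c - 1) *
        (1 - u - (1 - s + p * ρ)) ^ (-e)) *
      (1 - s + p * ρ) ^ (b - 1) * (t - (1 - s + p * ρ)) ^ (d - 1)
      = ∫ ρ in (0:ℝ)..1, ((K0 * Beta2 a (c - e)) * ff (C1 a c e) (bc (1 - b)) x y 1 d ρ +
        (K0 * x ^ (c - e) * Beta2 (1 - e) (e - c)) *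
          ff (C2 a c e) (bc (1 - b)) x y (c - e + 1) d ρ) := by
    apply intervalIntegral.integral_congr_ae
    filter_upwards [hae] with ρ hq' hqq
    obtain ⟨h0, h1⟩ := hq' hqq
    have h1' : 0 < 1 - ρ := by linarith
    have hpr : p * ρ < p := mul_lt_of_lt_one_right hp0 h1
    have hpr0 : 0 < p * ρ := by positivity
    have hxr0 : 0 < x * ρ := by positivity
    have hxr1 : x * ρ < 1 := lt_of_le_of_lt (mul_le_of_le_one_right hx0.le h1.le) hx1
    have hyr0 : 0 < y * (1 - ρ) := by positivity
    have hyr1 : y * (1 - ρ) < 1 :=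
      lt_of_le_of_lt (mul_le_of_le_one_right hy0.le (by linarith)) hy1
    rw [inner_eq a c e s (1 - s + p * ρ) hs0 (by linarith) (by linarith),
      show (1 - s + p * ρ - (1 - s)) / s = x * ρ by rw [hx]; ring,
      GG_formula a c e (x * ρ) ha he hnint hxr0 hxr1,
      show t - (1 - s + p * ρ) = p * (1 - ρ) by rw [hp]; ring,
      show 1 - s + p * ρ = t * (1 - y * (1 - ρ)) by rw [hy]; field_simp; rw [hp]; ring,
      Real.mul_rpow ht.le (by linarith), Real.mul_rpow hp0.le h1'.le,
      Real.mul_rpow hx0.le h0.le]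
    have hb' := (binom_hasSum (1 - b) (y * (1 - ρ)) (by rwa [abs_of_pos hyr0])).tsum_eq
    rw [neg_sub] at hb'
    unfold ff
    rw [hb', hK0, sub_self, Real.rpow_zero, show c - e + 1 - 1 = c - e by ring]
    ring
  have i1 := (ff_intble (C1 a c e) (bc (1 - b)) x y 1 d hx0.le hy0.le
    (hyp_summable e (e - a - c + 1) (e - c + 1) x hx0.le hx1) (bc_summable _ y hy0.le hy1)
    one_pos hd).const_mul (K0 * Beta2 a (c - e))
  have i2 := (ff_intble (C2 a c e) (bc (1 - b)) x y (c - e + 1) d hx0.le hy0.le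
    (hyp_summable (1 - a) c (c - e + 1) x hx0.le hx1) (bc_summable _ y hy0.le hy1)
    hce hd).const_mul (K0 * x ^ (c - e) * Beta2 (1 - e) (e - c))
  rw [hI, hJ, intervalIntegral.integral_add i1 i2, intervalIntegral.integral_const_mul,
    intervalIntegral.integral_const_mul, F3t_eq a b c d e x y hd hx0.le hy0.le hx1 hy1,
    F3_eq a b c d e x y hd hce hx0.le hy0.le hx1 hy1]
  have q1 : p ^ d = p ^ (d - 1) * p := by
    rw [← Real.rpow_add_one hp0.ne']; congr 1; ring
  have q2 : p ^ (c + d - e) = p ^ (c - e) * (p ^ (d - 1) * p) := by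
    rw [← q1, ← Real.rpow_add hp0]; congr 1; ring
  have q3 : x ^ (c - e) = p ^ (c - e) / s ^ (c - e) := Real.div_rpow hp0.le hs0.le _
  have q4 : s ^ (a - 1) = s ^ (a + c - e - 1) / s ^ (c - e) := by
    rw [← Real.rpow_sub hs0]; congr 1; ring
  rw [q2, q1, q3, q4, hK0]
  ring
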